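/- Let K be a field, V a K-vector space, and let X ⊆ Y be subsets of V that are both closed under scalar multiplication (i.e., cones: k • x ∈ X for all k ∈ K, x ∈ X, and similarly for Y). Fix an integer s ≥ 1. If every vector of V that can be written as a sum of s elements of Y can also be written as a sum of s elements of X, then every vector of V that can be written as a sum of s+1 elements of Y can also be written as a sum of s+1 elements of X. -/

import Mathlib

/-- Cone-level content of Lemma 1.4: if every sum of `s` elements of the cone `Y`
is a sum of `s` elements of the subcone `X`, the same holds for sums of `s+1` elements. -/
theorem secant_absorb_step {K V : Type*} [Field K] [AddCommGroup V] [Module K V]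
    (X Y : Set V) (hXY : X ⊆ Y)
    (hXcone : ∀ (k : K) (x : V), x ∈ X → k • x ∈ X)
    (hYcone : ∀ (k : K) (y : V), y ∈ Y → k • y ∈ Y)
    (s : ℕ) (hs : 1 ≤ s)
    (h : ∀ v : V, (∃ a : Fin s → V, (∀ i, a i ∈ Y) ∧ v = ∑ i, a i) →
      (∃ b : Fin s → V, (∀ i, b i ∈ X) ∧ v = ∑ i, b i)) :
    ∀ v : V, (∃ a : Fin (s + 1) → V, (∀ i, a i ∈ Y) ∧ v = ∑ i, a i) →
      (∃ b : Fin (s + 1) → V, (∀ i, b i ∈ X) ∧ v = ∑ i, b i) := by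
  rintro v ⟨a, ha, rfl⟩
  obtain ⟨t, rfl⟩ : ∃ t, s = t + 1 := ⟨s - 1, by omega⟩
  -- replace the last `s` summands by elements of `X`
  obtain ⟨b, hb, hab⟩ := h (∑ i, a (Fin.succ i)) ⟨fun i => a i.succ, fun i => ha _, rfl⟩
  -- set `b 0` aside and absorb `a 0` into the remaining summands
  obtain ⟨c, hc, hbc⟩ := h (a 0 + ∑ i, b (Fin.succ i))
    ⟨Fin.cons (a 0) (fun i => b i.succ), fun i => by
      refine Fin.cases ?_ (fun j => ?_) i
      · simpa using ha 0
      · simpa using hXY (hb j.succ), by simp [Fin.sum_univ_succ]⟩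
  refine ⟨Fin.cons (b 0) c, fun i => ?_, ?_⟩
  · refine Fin.cases ?_ (fun j => ?_) i
    · simpa using hb 0
    · simpa using hc j
  · rw [Fin.sum_univ_succ a, hab, Fin.sum_univ_succ b, Fin.sum_univ_succ (Fin.cons (b 0) c : Fin (t + 1 + 1) → V)]
    simp only [Fin.cons_zero, Fin.cons_succ]
    rw [← hbc]
    abel
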